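/- (The canonical element of a Manin triple satisfies CYBE.) Let (g, g₊, g₋) be a finite-dimensional Manin triple over ℂ, let (e₁,…,e_m) be a basis of g₊ and (f₁,…,f_m) the basis of g₋ dual to it with respect to the form, i.e. ⟨fᵢ, eⱼ⟩ = δᵢⱼ. Then the element r := Σᵢ ι(eᵢ)⊗ι(fᵢ) ∈ U(g)⊗U(g), where ι: g → U(g) is the canonical map into the universal enveloping algebra, satisfies the classical Yang–Baxter equation [r₁₂,r₁₃] + [r₁₂,r₂₃] + [r₁₃,r₂₃] = 0 in U(g)⊗U(g)⊗U(g). -/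

import Mathlib

/-!
STATEMENT 10 (The canonical element of a Manin triple satisfies CYBE):
Let `(g, g₊, g₋)` be a finite-dimensional Manin triple over `ℂ`, `(e₁,…,e_m)` a basis of
`g₊` and `(f₁,…,f_m)` the dual basis of `g₋` (`⟨fᵢ, eⱼ⟩ = δᵢⱼ`). Then
`r = Σᵢ ι(eᵢ) ⊗ ι(fᵢ) ∈ U(g) ⊗ U(g)` satisfies the classical Yang–Baxter equation
`[r₁₂,r₁₃] + [r₁₂,r₂₃] + [r₁₃,r₂₃] = 0` in `U(g)^{⊗3}`.
-/

open scoped TensorProduct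
open PiTensorProduct

noncomputable section

section TensorLegs

variable {A : Type*} [Ring A] [Algebra ℂ A]

/-- `a^{(j)} = 1 ⊗ ⋯ ⊗ a ⊗ ⋯ ⊗ 1 ∈ A^{⊗n}`, with `a` in the `j`-th factor. -/
def single (n : ℕ) (j : Fin n) (a : A) : ⨂[ℂ] _ : Fin n, A :=
  tprod ℂ (Function.update (fun _ => (1 : A)) j a)

lemma single_add (n : ℕ) (j : Fin n) (a b : A) :
    single n j (a + b) = single n j a + single n j b := by
  simp [single]

lemma single_smul (n : ℕ) (j : Fin n) (c : ℂ) (a : A) :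
    single n j (c • a) = c • single n j a := by
  simp [single]

/-- `leg2 n j k` sends `x = Σ aᵢ ⊗ bᵢ ∈ A ⊗ A` to `x_{jk} = Σ aᵢ^{(j)} · bᵢ^{(k)} ∈ A^{⊗n}`,
i.e. the image of `x` with its first leg in tensor factor `j` and second leg in factor `k`. -/
def leg2 (n : ℕ) (j k : Fin n) : (A ⊗[ℂ] A) →ₗ[ℂ] ⨂[ℂ] _ : Fin n, A :=
  TensorProduct.lift <| LinearMap.mk₂ ℂ (fun a b => single n j a * single n k b)
    (fun a a' b => by rw [single_add, add_mul])
    (fun c a b => by rw [single_smul, smul_mul_assoc])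
    (fun a b b' => by rw [single_add, mul_add])
    (fun c a b => by rw [single_smul, mul_smul_comm])

/-- The classical Yang–Baxter equation `[r₁₂,r₁₃] + [r₁₂,r₂₃] + [r₁₃,r₂₃] = 0` in `A^{⊗3}`. -/
def CYBE (r : A ⊗[ℂ] A) : Prop :=
  (leg2 3 0 1 r * leg2 3 0 2 r - leg2 3 0 2 r * leg2 3 0 1 r) +
  (leg2 3 0 1 r * leg2 3 1 2 r - leg2 3 1 2 r * leg2 3 0 1 r) +
  (leg2 3 0 2 r * leg2 3 1 2 r - leg2 3 1 2 r * leg2 3 0 2 r) = 0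

end TensorLegs

lemma single_mul_same {A : Type*} [Ring A] [Algebra ℂ A] (n : ℕ) (j : Fin n) (a b : A) :
    single n j a * single n j b = single n j (a * b) := by
  unfold single
  rw [PiTensorProduct.tprod_mul_tprod]
  congr 1
  funext k
  by_cases h : k = j
  · subst h; simp
  · simp [h]

lemma single_commute {A : Type*} [Ring A] [Algebra ℂ A] (n : ℕ) {j k : Fin n} (hjk : j ≠ k)
    (a b : A) : single n j a * single n k b = single n k b * single n j a := by
  unfold single
  rw [PiTensorProduct.tprod_mul_tprod, PiTensorProduct.tprod_mul_tprod]
  congr 1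
  funext l
  by_cases h : l = j
  · subst h; simp [hjk]
  · simp [h]

/-- The composite of `ι` with the inclusion in the `j`-th factor. -/
def phiLeg (g : Type*) [LieRing g] [LieAlgebra ℂ g] (j : Fin 3) :
    g →ₗ[ℂ] ⨂[ℂ] _ : Fin 3, UniversalEnvelopingAlgebra ℂ g where
  toFun x := single 3 j (UniversalEnvelopingAlgebra.ι ℂ x)
  map_add' x y := by rw [map_add, single_add]
  map_smul' c x := by rw [map_smul, single_smul]; rfl

lemma phiLeg_lie {g : Type*} [LieRing g] [LieAlgebra ℂ g] (j : Fin 3) (x y : g) :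
    phiLeg g j ⁅x, y⁆ = phiLeg g j x * phiLeg g j y - phiLeg g j y * phiLeg g j x := by
  have h : ∀ a b : UniversalEnvelopingAlgebra ℂ g,
      single 3 j (a - b) = single 3 j a - single 3 j b := by
    intro a b
    rw [eq_sub_iff_add_eq, ← single_add, sub_add_cancel]
  simp only [phiLeg, LinearMap.coe_mk, AddHom.coe_mk, single_mul_same]
  rw [← h]
  letI : LieRing (UniversalEnvelopingAlgebra ℂ g) := LieRing.ofAssociativeRing
  exact congrArg (single 3 j) ((UniversalEnvelopingAlgebra.ι ℂ).map_lie x y)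

lemma phiLeg_comm {g : Type*} [LieRing g] [LieAlgebra ℂ g] {j k : Fin 3} (h : j ≠ k) (x y : g) :
    phiLeg g j x * phiLeg g k y = phiLeg g k y * phiLeg g j x :=
  single_commute 3 h _ _

lemma leg2_sum {g : Type*} [LieRing g] [LieAlgebra ℂ g] {m : ℕ} (j k : Fin 3) (e f : Fin m → g) :
    leg2 3 j k (∑ i : Fin m,
      (UniversalEnvelopingAlgebra.ι ℂ (e i)) ⊗ₜ[ℂ] (UniversalEnvelopingAlgebra.ι ℂ (f i)))
      = ∑ i : Fin m, phiLeg g j (e i) * phiLeg g k (f i) := by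
  rw [map_sum]
  rfl

lemma cybe_abstract {g R : Type*} [LieRing g] [LieAlgebra ℂ g] [Ring R] [Algebra ℂ R]
    (p q s : g →ₗ[ℂ] R)
    (hp : ∀ x y, p ⁅x, y⁆ = p x * p y - p y * p x)
    (hq : ∀ x y, q ⁅x, y⁆ = q x * q y - q y * q x)
    (hs : ∀ x y, s ⁅x, y⁆ = s x * s y - s y * s x)
    (hpq : ∀ x y, p x * q y = q y * p x)
    (hps : ∀ x y, p x * s y = s y * p x)
    (hqs : ∀ x y, q x * s y = s y * q x)
    {m : ℕ} (e f : Fin m → g) (a b : Fin m → Fin m → Fin m → ℂ)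
    (hee : ∀ i j, ⁅e i, e j⁆ = ∑ k, a i j k • e k)
    (hff : ∀ i j, ⁅f i, f j⁆ = ∑ k, b i j k • f k)
    (hfe : ∀ i j, ⁅f i, e j⁆ = ∑ k, (-(b i k j)) • e k + ∑ k, (-(a k j i)) • f k) :
    ((∑ i, p (e i) * q (f i)) * (∑ i, p (e i) * s (f i))
      - (∑ i, p (e i) * s (f i)) * (∑ i, p (e i) * q (f i)))
    + ((∑ i, p (e i) * q (f i)) * (∑ i, q (e i) * s (f i))
      - (∑ i, q (e i) * s (f i)) * (∑ i, p (e i) * q (f i)))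
    + ((∑ i, p (e i) * s (f i)) * (∑ i, q (e i) * s (f i))
      - (∑ i, q (e i) * s (f i)) * (∑ i, p (e i) * s (f i))) = 0 := by
  have h1 : (∑ i, p (e i) * q (f i)) * (∑ i, p (e i) * s (f i))
      - (∑ i, p (e i) * s (f i)) * (∑ i, p (e i) * q (f i))
      = ∑ i, ∑ j, ∑ k, a i j k • (p (e k) * q (f i) * s (f j)) := by
    rw [Finset.sum_mul_sum, Finset.sum_mul_sum, Finset.sum_comm (γ := Fin m) (f := fun i j =>
      p (e i) * s (f i) * (p (e j) * q (f j))), ← Finset.sum_sub_distrib]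
    refine Finset.sum_congr rfl fun i _ => ?_
    rw [← Finset.sum_sub_distrib]
    refine Finset.sum_congr rfl fun j _ => ?_
    trans p ⁅e i, e j⁆ * q (f i) * s (f j)
    · rw [hp, sub_mul, sub_mul]
      congr 1
      · simp only [mul_assoc]
        rw [← mul_assoc (q _) (p _), ← hpq, mul_assoc]
      · simp only [mul_assoc]
        rw [← mul_assoc (s _) (p _), ← hps, mul_assoc, hqs]
    · rw [hee]
      simp [Finset.sum_mul]
  have h3 : (∑ i, p (e i) * s (f i)) * (∑ i, q (e i) * s (f i))
      - (∑ i, q (e i) * s (f i)) * (∑ i, p (e i) * s (f i))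
      = ∑ i, ∑ j, ∑ k, b i j k • (p (e i) * q (e j) * s (f k)) := by
    rw [Finset.sum_mul_sum, Finset.sum_mul_sum, Finset.sum_comm (γ := Fin m) (f := fun i j =>
      q (e i) * s (f i) * (p (e j) * s (f j))), ← Finset.sum_sub_distrib]
    refine Finset.sum_congr rfl fun i _ => ?_
    rw [← Finset.sum_sub_distrib]
    refine Finset.sum_congr rfl fun j _ => ?_
    trans p (e i) * q (e j) * s ⁅f i, f j⁆
    · rw [hs, mul_sub]
      congr 1
      · simp only [mul_assoc]
        rw [← mul_assoc (s _) (q _), ← hqs, mul_assoc]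
      · simp only [mul_assoc]
        rw [← mul_assoc (s _) (p _), ← hps, ← mul_assoc (p _) (q _), hpq]
        simp only [mul_assoc]
    · rw [hff]
      simp [Finset.mul_sum]
  have h2 : (∑ i, p (e i) * q (f i)) * (∑ i, q (e i) * s (f i))
      - (∑ i, q (e i) * s (f i)) * (∑ i, p (e i) * q (f i))
      = ∑ i, ∑ j, (∑ k, (-(b i k j)) • (p (e i) * q (e k) * s (f j))
        + ∑ k, (-(a k j i)) • (p (e i) * q (f k) * s (f j))) := by
    rw [Finset.sum_mul_sum, Finset.sum_mul_sum, Finset.sum_comm (γ := Fin m) (f := fun i j =>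
      q (e i) * s (f i) * (p (e j) * q (f j))), ← Finset.sum_sub_distrib]
    refine Finset.sum_congr rfl fun i _ => ?_
    rw [← Finset.sum_sub_distrib]
    refine Finset.sum_congr rfl fun j _ => ?_
    trans p (e i) * q ⁅f i, e j⁆ * s (f j)
    · rw [hq, mul_sub, sub_mul]
      congr 1
      · simp only [mul_assoc]
      · simp only [mul_assoc]
        rw [← mul_assoc (s _) (p _), ← hps, mul_assoc, ← hqs, ← mul_assoc, ← hpq, mul_assoc]
    · rw [hfe, map_add, mul_add, add_mul]
      simp only [map_sum, map_smul, Finset.mul_sum, Finset.sum_mul, mul_smul_comm,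
        smul_mul_assoc]
  rw [h1, h2, h3]
  simp only [Finset.sum_add_distrib, neg_smul, Finset.sum_neg_distrib]
  have e1 : ∑ i, ∑ j, ∑ k, a k j i • (p (e i) * q (f k) * s (f j))
      = ∑ i, ∑ j, ∑ k, a i j k • (p (e k) * q (f i) * s (f j)) := by
    rw [Finset.sum_comm]
    conv_rhs => rw [Finset.sum_comm]
    exact Finset.sum_congr rfl fun j _ => Finset.sum_comm
  have e2 : ∑ i, ∑ j, ∑ k, b i k j • (p (e i) * q (e k) * s (f j))
      = ∑ i, ∑ j, ∑ k, b i j k • (p (e i) * q (e j) * s (f k)) :=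
    Finset.sum_congr rfl fun i _ => Finset.sum_comm
  rw [e1, e2]
  abel

/-- The canonical element of a finite-dimensional Manin triple satisfies the classical
Yang–Baxter equation in `U(g)^{⊗3}`. -/
theorem maninTriple_canonical_element_CYBE
    {g : Type*} [LieRing g] [LieAlgebra ℂ g] [FiniteDimensional ℂ g]
    (B : g →ₗ[ℂ] g →ₗ[ℂ] ℂ)
    (hsymm : ∀ x y : g, B x y = B y x)
    (hinv : ∀ x y z : g, B ⁅x, y⁆ z = B x ⁅y, z⁆)
    (hnondeg : ∀ x : g, (∀ y : g, B x y = 0) → x = 0)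
    (gp gm : LieSubalgebra ℂ g)
    (hgp_iso : ∀ x ∈ gp, ∀ y ∈ gp, B x y = 0)
    (hgm_iso : ∀ x ∈ gm, ∀ y ∈ gm, B x y = 0)
    (hcompl : IsCompl gp.toSubmodule gm.toSubmodule)
    (m : ℕ) (e : Module.Basis (Fin m) ℂ gp) (f : Module.Basis (Fin m) ℂ gm)
    (hdual : ∀ i j : Fin m, B (f i : g) (e j : g) = if i = j then 1 else 0) :
    CYBE (∑ i : Fin m,
      (UniversalEnvelopingAlgebra.ι ℂ (e i : g)) ⊗ₜ[ℂ]
        (UniversalEnvelopingAlgebra.ι ℂ (f i : g))) := by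
  have hep : ∀ x ∈ gp, x = ∑ k, B x (f k : g) • (e k : g) := by
    intro x hx
    have h := congrArg (Subtype.val) (e.sum_repr ⟨x, hx⟩)
    simp only [AddSubmonoidClass.coe_finsetSum, SetLike.val_smul] at h
    have hc : ∀ k, B x (f k : g) = e.repr ⟨x, hx⟩ k := by
      intro k
      rw [hsymm]
      conv_lhs => rw [← h]
      simp [hdual]
    simp only [hc]
    exact h.symm
  have hfm : ∀ x ∈ gm, x = ∑ k, B x (e k : g) • (f k : g) := by
    intro x hx
    have h := congrArg (Subtype.val) (f.sum_repr ⟨x, hx⟩)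
    simp only [AddSubmonoidClass.coe_finsetSum, SetLike.val_smul] at h
    have hc : ∀ k, B x (e k : g) = f.repr ⟨x, hx⟩ k := by
      intro k
      conv_lhs => rw [← h]
      simp [hdual]
    simp only [hc]
    exact h.symm
  have hall : ∀ x : g, x = ∑ k, B x (f k : g) • (e k : g) + ∑ k, B x (e k : g) • (f k : g) := by
    intro x
    have hx : x ∈ gp.toSubmodule ⊔ gm.toSubmodule := by
      rw [hcompl.sup_eq_top]; trivial
    obtain ⟨y, hy, z, hz, rfl⟩ := Submodule.mem_sup.mp hx
    have h1 : ∀ k, B (y + z) (f k : g) = B y (f k : g) := by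
      intro k
      rw [map_add, LinearMap.add_apply, hgm_iso z hz _ (f k).2, add_zero]
    have h2 : ∀ k, B (y + z) (e k : g) = B z (e k : g) := by
      intro k
      rw [map_add, LinearMap.add_apply, hgp_iso y hy _ (e k).2, zero_add]
    simp only [h1, h2]
    rw [← hep y hy, ← hfm z hz]
  unfold CYBE
  simp only [leg2_sum _ _ (fun i => (e i : g)) (fun i => (f i : g))]
  refine cybe_abstract (phiLeg g 0) (phiLeg g 1) (phiLeg g 2) (phiLeg_lie 0) (phiLeg_lie 1)
    (phiLeg_lie 2) (phiLeg_comm (by decide)) (phiLeg_comm (by decide)) (phiLeg_comm (by decide))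
    (fun i => (e i : g)) (fun i => (f i : g))
    (fun i j k => B ⁅(e i : g), (e j : g)⁆ (f k : g))
    (fun i j k => B ⁅(f i : g), (f j : g)⁆ (e k : g)) ?_ ?_ ?_
  · intro i j
    exact hep _ (gp.lie_mem (e i).2 (e j).2)
  · intro i j
    exact hfm _ (gm.lie_mem (f i).2 (f j).2)
  · intro i j
    have h1 : ∀ k, -(B ⁅(f i : g), (f k : g)⁆ (e j : g)) = B ⁅(f i : g), (e j : g)⁆ (f k : g) := by
      intro k
      rw [hinv, hinv, ← lie_skew, map_neg, neg_neg]
    have h2 : ∀ k, -(B ⁅(e k : g), (e j : g)⁆ (f i : g)) = B ⁅(f i : g), (e j : g)⁆ (e k : g) := by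
      intro k
      rw [hinv (f i : g), hsymm, ← lie_skew, map_neg, neg_neg]
    simp only [h1, h2]
    exact hall _

end
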